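/- Let H be a complex Hilbert space and T a power bounded linear operator on H, i.e. sup_{n≥1} ‖T^n‖ < ∞. Suppose there exist constants C > 0 and 0 < s < 1/2 such that m(T^n) ≥ 1/(C e^{n^s}) for all n ≥ 1, and suppose the spectrum of T is countable. Then T is similar to a unitary operator: there exists an invertible bounded linear operator L on H such that L^{-1} T L is a unitary operator on H. -/

import Mathlib

universe u

/-- The minimum modulus `m(T) = inf {‖T x‖ : ‖x‖ = 1}` of a bounded operator. -/
noncomputable def minMod {X : Type*} [NormedAddCommGroup X] [NormedSpace ℂ X]
    (T : X →L[ℂ] X) : ℝ :=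
  sInf ((fun x : X => ‖T x‖) '' {x : X | ‖x‖ = 1})

open Filter Topology Bornology Asymptotics

theorem PhragmenLindelof.right_half_plane_of_subexponential_on_real
    {E : Type*} [NormedAddCommGroup E] [NormedSpace ℂ E] {f : ℂ → E} {C : ℝ}
    (hd : DiffContOnCl ℂ f {z | 0 < z.re})
    (hexp : ∃ c < (2 : ℝ), ∃ B,
      f =O[cobounded ℂ ⊓ 𝓟 {z | 0 < z.re}] fun z => Real.exp (B * ‖z‖ ^ c))
    (hre : ∀ ε > 0, ∃ B, ∀ x : ℝ, 0 ≤ x → ‖f x‖ ≤ B * Real.exp (ε * x))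
    (him : ∀ x : ℝ, ‖f (x * Complex.I)‖ ≤ C) {z : ℂ} (hz : 0 ≤ z.re) : ‖f z‖ ≤ C := by
  have key : ∀ ε : ℝ, 0 < ε → ‖Complex.exp (-(ε * z)) • f z‖ ≤ C := by
    intro ε hε
    have hdiff : Differentiable ℂ fun z : ℂ => Complex.exp (-(ε * z)) := by fun_prop
    refine PhragmenLindelof.right_half_plane_of_bounded_on_real
      (f := fun z => Complex.exp (-(ε * z)) • f z) (hdiff.diffContOnCl.smul hd) ?_ ?_ ?_ hz
    · obtain ⟨c, hc, B, h⟩ := hexp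
      refine ⟨c, hc, B, IsBigO.trans (IsBigO.of_bound 1 ?_) h⟩
      filter_upwards [mem_inf_of_right (mem_principal_self _)] with w hw
      have hw' : 0 < w.re := hw
      rw [norm_smul, Complex.norm_exp]
      gcongr
      simp
      positivity
    · obtain ⟨B, hB⟩ := hre ε hε
      refine isBoundedUnder_of_eventually_le (a := B) ?_
      filter_upwards [eventually_ge_atTop 0] with x hx
      rw [norm_smul, Complex.norm_exp]
      calc _ ≤ Real.exp (-(ε * x)) * (B * Real.exp (ε * x)) := by
            gcongr
            · simp
            · exact hB x hx
        _ = B := by rw [Real.exp_neg]; field_simp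
    · intro x
      rw [norm_smul, Complex.norm_exp]
      simpa using him x
  have hlim : Tendsto (fun ε : ℝ => ‖Complex.exp (-(ε * z)) • f z‖) (𝓝[>] 0) (𝓝 ‖f z‖) := by
    have : ContinuousAt (fun ε : ℝ => ‖Complex.exp (-(ε * z)) • f z‖) 0 := by fun_prop
    simpa using this.tendsto.mono_left nhdsWithin_le_nhds
  exact le_of_tendsto hlim (eventually_nhdsWithin_of_forall key)

theorem one_add_sq_rpow_le {s x : ℝ} (hs0 : 0 < s) (hx : 0 ≤ x) :
    (1 + x ^ 2) ^ s ≤ (1 + x) ^ (2 * s) := by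
  rw [Real.rpow_mul (by positivity)]
  gcongr
  norm_num
  nlinarith

theorem exists_mul_rpow_le_mul_add {p ε : ℝ} (K : ℝ) (hp0 : 0 ≤ p) (hp : p < 1) (hε : 0 < ε) :
    ∃ B, ∀ x : ℝ, 0 ≤ x → K * (1 + x) ^ p ≤ ε * x + B := by
  have h : Tendsto (fun x : ℝ => |K| * x ^ (-(1 - p))) atTop (𝓝 (|K| * 0)) :=
    (tendsto_rpow_neg_atTop (by linarith)).const_mul _
  rw [mul_zero] at h
  obtain ⟨R, hR, hR0⟩ := ((h.eventually_le_const hε).and (eventually_gt_atTop 0)).exists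
  refine ⟨ε + |K| * R ^ p, fun x hx => ?_⟩
  have h1 : K * (1 + x) ^ p ≤ |K| * (1 + x) ^ p := by gcongr; exact le_abs_self K
  refine h1.trans ?_
  rcases le_total (1 + x) R with hxR | hxR
  · have : |K| * (1 + x) ^ p ≤ |K| * R ^ p := by gcongr
    have : 0 ≤ ε * x := by positivity
    linarith
  · have h2 : (1 + x) ^ p = (1 + x) * (1 + x) ^ (-(1 - p)) := by
      conv_lhs => rw [show p = 1 + -(1 - p) by ring, Real.rpow_add (by positivity), Real.rpow_one]
    have h3 : (1 + x) ^ (-(1 - p)) ≤ R ^ (-(1 - p)) :=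
      Real.rpow_le_rpow_of_nonpos hR0 hxR (by linarith)
    have h4 : 0 ≤ |K| * R ^ p := by positivity
    calc |K| * (1 + x) ^ p = (1 + x) * (|K| * (1 + x) ^ (-(1 - p))) := by rw [h2]; ring
      _ ≤ (1 + x) * (|K| * R ^ (-(1 - p))) := by gcongr
      _ ≤ (1 + x) * ε := by gcongr
      _ ≤ _ := by linarith

theorem re_cpow_ge {s : ℝ} (hs0 : 0 ≤ s) (hs1 : s ≤ 1) {w : ℂ} (hw : 0 < w.re) :
    Real.cos (Real.pi / 2 * s) * ‖w‖ ^ s ≤ (w ^ (s : ℂ)).re := by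
  have hne : w ≠ 0 := by rintro rfl; simp at hw
  rw [Complex.cpow_def_of_ne_zero hne, Complex.exp_re, mul_comm (Real.cos _)]
  have h1 : (Complex.log w * s).re = Real.log ‖w‖ * s := by simp [Complex.log_re]
  have h2 : (Complex.log w * s).im = w.arg * s := by simp [Complex.log_im]
  rw [h1, h2, Real.rpow_def_of_pos (by positivity)]
  have h3 : |w.arg| ≤ Real.pi / 2 := Complex.abs_arg_le_pi_div_two_iff.2 hw.le
  gcongr
  rw [← Real.cos_abs (w.arg * s), abs_mul, abs_of_nonneg hs0]
  apply Real.cos_le_cos_of_nonneg_of_le_pi (by positivity)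
  · nlinarith [Real.pi_pos]
  · gcongr

/-- An entire function of subexponential type which is bounded on the imaginary axis by
`D * exp (K * (1 + |x|) ^ s)`, `s < 1`, obeys a bound of the same form on the right half-plane. -/
theorem norm_le_exp_of_half_plane {E : Type*} [NormedAddCommGroup E] [NormedSpace ℂ E]
    {f : ℂ → E} {D K s : ℝ} (hs0 : 0 ≤ s) (hs1 : s < 1) (hK : 0 ≤ K) (hf : Differentiable ℂ f)
    (htype : ∀ ε > 0, ∃ B, ∀ z, ‖f z‖ ≤ B * Real.exp (ε * ‖z‖))
    (him : ∀ x : ℝ, ‖f (x * Complex.I)‖ ≤ D * Real.exp (K * (1 + |x|) ^ s))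
    {z : ℂ} (hz : 0 ≤ z.re) :
    ‖f z‖ ≤ D * Real.exp (2 * K / Real.cos (Real.pi / 2 * s) * (1 + ‖z‖) ^ s) := by
  have hcos : 0 < Real.cos (Real.pi / 2 * s) :=
    Real.cos_pos_of_mem_Ioo ⟨by nlinarith [Real.pi_pos], by nlinarith [Real.pi_pos]⟩
  set K' := 2 * K / Real.cos (Real.pi / 2 * s) with hK'
  have hK'0 : 0 ≤ K' := by positivity
  set φ : ℂ → ℂ := fun w => Complex.exp (-(K' * (1 + w) ^ (s : ℂ))) with hφ
  have hφnorm : ∀ w, ‖φ w‖ = Real.exp (-(K' * ((1 + w) ^ (s : ℂ)).re)) := by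
    intro w
    simp [hφ, Complex.norm_exp]
  have hφlow : ∀ w : ℂ, 0 ≤ w.re → 2 * K * ‖1 + w‖ ^ s ≤ K' * ((1 + w) ^ (s : ℂ)).re := by
    intro w hw
    have h1 := re_cpow_ge hs0 hs1.le (w := 1 + w) (by simp; linarith)
    calc 2 * K * ‖1 + w‖ ^ s = K' * (Real.cos (Real.pi / 2 * s) * ‖1 + w‖ ^ s) := by
          rw [hK', ← mul_assoc, div_mul_cancel₀ _ hcos.ne']
      _ ≤ _ := by gcongr
  have hφ1 : ∀ w : ℂ, 0 ≤ w.re → ‖φ w‖ ≤ 1 := by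
    intro w hw
    rw [hφnorm, Real.exp_le_one_iff]
    have := hφlow w hw
    have : 0 ≤ 2 * K * ‖1 + w‖ ^ s := by positivity
    linarith
  have hmain : ‖φ z • f z‖ ≤ D := by
    refine PhragmenLindelof.right_half_plane_of_subexponential_on_real
      (f := fun z => φ z • f z) ?_ ?_ ?_ ?_ hz
    · have hd : ∀ w : ℂ, 0 ≤ w.re → DifferentiableAt ℂ (fun z => φ z • f z) w := by
        intro w hw
        have : 1 + w ∈ Complex.slitPlane := Or.inl (by simp; linarith)
        refine DifferentiableAt.smul ?_ (hf w)
        refine ((DifferentiableAt.cpow_const (by fun_prop) this).const_mul _).neg.cexp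
      refine ⟨fun w hw => (hd w (le_of_lt hw)).differentiableWithinAt, fun w hw => ?_⟩
      rw [Complex.closure_setOfPred_lt_re] at hw
      exact (hd w hw).continuousAt.continuousWithinAt
    · obtain ⟨B, hB⟩ := htype 1 one_pos
      refine ⟨1, by norm_num, 1, IsBigO.of_bound B ?_⟩
      filter_upwards [mem_inf_of_right (mem_principal_self _)] with w hw
      have hw' : 0 ≤ w.re := le_of_lt hw
      rw [norm_smul]
      calc _ ≤ 1 * ‖f w‖ := by gcongr; exact hφ1 w hw'
        _ ≤ _ := by simpa using hB w
    · intro ε hε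
      obtain ⟨B, hB⟩ := htype ε hε
      refine ⟨B, fun x hx => ?_⟩
      rw [norm_smul]
      calc _ ≤ 1 * ‖f x‖ := by gcongr; exact hφ1 x (by simpa using hx)
        _ ≤ _ := by simpa [abs_of_nonneg hx] using hB x
    · intro x
      have h1 := hφlow (x * Complex.I) (by simp)
      have h2 : 1 + |x| ≤ 2 * ‖1 + x * Complex.I‖ := by
        have h3 := Complex.abs_re_le_norm (1 + x * Complex.I)
        have h4 := Complex.abs_im_le_norm (1 + x * Complex.I)
        simp at h3 h4
        linarith
      have h3 : (1 + |x|) ^ s ≤ 2 * ‖1 + x * Complex.I‖ ^ s := by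
        calc (1 + |x|) ^ s ≤ (2 * ‖1 + x * Complex.I‖) ^ s := by gcongr
          _ = 2 ^ s * ‖1 + x * Complex.I‖ ^ s := Real.mul_rpow (by norm_num) (by positivity)
          _ ≤ 2 ^ (1 : ℝ) * ‖1 + x * Complex.I‖ ^ s := by gcongr; norm_num
          _ = _ := by rw [Real.rpow_one]
      have hD : 0 ≤ D := by
        have := (norm_nonneg _).trans (him 0)
        exact nonneg_of_mul_nonneg_left this (Real.exp_pos _)
      rw [norm_smul, hφnorm]
      calc _ ≤ Real.exp (-(2 * K * ‖1 + x * Complex.I‖ ^ s)) *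
            (D * Real.exp (K * (2 * ‖1 + x * Complex.I‖ ^ s))) := by
            gcongr
            exact (him x).trans (by gcongr)
        _ = D := by rw [Real.exp_neg]; field_simp
  have hφz : Real.exp (-(K' * (1 + ‖z‖) ^ s)) ≤ ‖φ z‖ := by
    rw [hφnorm]
    gcongr
    have h1 : ((1 + z) ^ (s : ℂ)).re ≤ ‖1 + z‖ ^ s := by
      refine (Complex.re_le_norm _).trans ?_
      rw [Complex.norm_cpow_real]
    refine h1.trans ?_
    gcongr
    simpa using norm_add_le 1 z
  have h5 : Real.exp (-(K' * (1 + ‖z‖) ^ s)) * ‖f z‖ ≤ D := by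
    rw [norm_smul] at hmain
    exact le_trans (by gcongr) hmain
  rw [Real.exp_neg, inv_mul_le_iff₀ (Real.exp_pos _)] at h5
  linarith

theorem eq_of_subexponential {E : Type*} [NormedAddCommGroup E] [NormedSpace ℂ E]
    {f : ℂ → E} {M D K s : ℝ} (hs0 : 0 < s) (hs1 : s < 1 / 2) (hK : 0 ≤ K)
    (hf : Differentiable ℂ f)
    (htype : ∀ ε > 0, ∃ B, ∀ z, ‖f z‖ ≤ B * Real.exp (ε * ‖z‖))
    (hpos : ∀ x : ℝ, 0 ≤ x → ‖f x‖ ≤ M)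
    (hneg : ∀ x : ℝ, 0 ≤ x → ‖f (-x)‖ ≤ D * Real.exp (K * (1 + x) ^ s)) (z w : ℂ) :
    f z = f w := by
  have hM : 0 ≤ M := (norm_nonneg _).trans (hpos 0 le_rfl)
  set D' := max M D with hD'
  have hD'0 : 0 ≤ D' := hM.trans (le_max_left _ _)
  have hreal : ∀ x : ℝ, ‖f x‖ ≤ D' * Real.exp (K * (1 + |x|) ^ s) := by
    intro x
    rcases le_total 0 x with hx | hx
    · calc ‖f x‖ ≤ M := hpos x hx
        _ ≤ D' * 1 := by rw [mul_one]; exact le_max_left _ _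
        _ ≤ _ := by gcongr; exact Real.one_le_exp (by positivity)
    · have := hneg (-x) (by linarith)
      rw [Complex.ofReal_neg, neg_neg] at this
      rw [abs_of_nonpos hx]
      exact this.trans (by gcongr; exact le_max_right _ _)
  set K' := 2 * K / Real.cos (Real.pi / 2 * s) with hK'
  have hcos : 0 < Real.cos (Real.pi / 2 * s) :=
    Real.cos_pos_of_mem_Ioo ⟨by nlinarith [Real.pi_pos], by nlinarith [Real.pi_pos]⟩
  have hK'0 : 0 ≤ K' := by positivity
  have hrot : ∀ c : ℂ, (c = Complex.I ∨ c = -Complex.I) → ∀ u : ℂ, 0 ≤ u.re →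
      ‖f (c * u)‖ ≤ D' * Real.exp (K' * (1 + ‖u‖) ^ s) := by
    intro c hc u hu
    have hcn : ‖c‖ = 1 := by rcases hc with rfl | rfl <;> simp
    refine norm_le_exp_of_half_plane (f := fun u => f (c * u)) hs0.le (by linarith) hK
      (by fun_prop) ?_ ?_ hu
    · intro ε hε
      obtain ⟨B, hB⟩ := htype ε hε
      exact ⟨B, fun u => by simpa [hcn] using hB (c * u)⟩
    · intro x
      rcases hc with rfl | rfl
      · have := hreal (-x)
        have e : Complex.I * (x * Complex.I) = ((-x : ℝ) : ℂ) := by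
          rw [mul_left_comm, Complex.I_mul_I]; simp
        rw [e]
        simpa using this
      · have := hreal x
        have e : -Complex.I * (x * Complex.I) = (x : ℂ) := by
          rw [mul_left_comm, neg_mul, Complex.I_mul_I]; simp
        rw [e]
        exact this
  have hall : ∀ u : ℂ, ‖f u‖ ≤ D' * Real.exp (K' * (1 + ‖u‖) ^ s) := by
    intro u
    rcases le_total 0 u.im with h | h
    · have := hrot Complex.I (Or.inl rfl) (-Complex.I * u) (by simpa using h)
      rw [← mul_assoc] at this
      simpa using this
    · have := hrot (-Complex.I) (Or.inr rfl) (Complex.I * u) (by simpa using h)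
      rw [← mul_assoc] at this
      simpa using this
  have hsq : ∀ v : ℂ, 0 ≤ v.re → ‖f (-v ^ 2)‖ ≤ M := by
    intro v hv
    have hbd : ∀ ε > 0, ∃ B, ∀ v : ℂ, ‖f (-v ^ 2)‖ ≤ B * Real.exp (ε * ‖v‖) := by
      intro ε hε
      obtain ⟨B, hB⟩ := exists_mul_rpow_le_mul_add K' (p := 2 * s) (by linarith) (by linarith) hε
      refine ⟨D' * Real.exp B, fun v => (hall _).trans ?_⟩
      rw [mul_assoc, ← Real.exp_add]
      gcongr
      rw [norm_neg, norm_pow]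
      calc K' * (1 + ‖v‖ ^ 2) ^ s ≤ K' * (1 + ‖v‖) ^ (2 * s) := by
            gcongr; exact one_add_sq_rpow_le hs0 (norm_nonneg _)
        _ ≤ _ := by linarith [hB ‖v‖ (norm_nonneg _)]
    have hd : Differentiable ℂ fun v : ℂ => f (-v ^ 2) := by fun_prop
    refine PhragmenLindelof.right_half_plane_of_subexponential_on_real
      (f := fun v => f (-v ^ 2)) hd.diffContOnCl ?_ ?_ ?_ hv
    · obtain ⟨B, hB⟩ := hbd 1 one_pos
      refine ⟨1, by norm_num, 1, IsBigO.of_bound B (Eventually.of_forall fun w => ?_)⟩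
      simpa using hB w
    · intro ε hε
      obtain ⟨B, hB⟩ := hbd ε hε
      exact ⟨B, fun x hx => by simpa [abs_of_nonneg hx] using hB x⟩
    · intro x
      have := hpos (x ^ 2) (by positivity)
      simpa [mul_pow] using this
  refine hf.apply_eq_apply_of_bounded ?_ z w
  rw [isBounded_iff_forall_norm_le]
  refine ⟨M, ?_⟩
  rintro _ ⟨u, rfl⟩
  obtain ⟨v, hv⟩ := IsAlgClosed.exists_pow_nat_eq (-u) (n := 2) (by norm_num)
  rcases le_total 0 v.re with h | h
  · have := hsq v h
    rwa [hv, neg_neg] at this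
  · have := hsq (-v) (by simpa using h)
    rwa [neg_sq, hv, neg_neg] at this

theorem differentiable_intervalIntegral_exp_smul {E : Type*} [NormedAddCommGroup E]
    [NormedSpace ℂ E] {a b : ℝ} {ℓ : ℝ → ℂ} {G : ℝ → E} (hℓ : Continuous ℓ) (hG : Continuous G) :
    Differentiable ℂ fun t : ℂ => ∫ θ in a..b, Complex.exp (t * ℓ θ) • G θ := by
  intro t₀
  obtain ⟨L, hL⟩ := (isCompact_uIcc (a := a) (b := b)).exists_bound_of_continuousOn hℓ.continuousOn
  obtain ⟨N, hN⟩ := (isCompact_uIcc (a := a) (b := b)).exists_bound_of_continuousOn hG.continuousOn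
  have hcont : ∀ t : ℂ, Continuous fun θ => Complex.exp (t * ℓ θ) • G θ := fun t => by fun_prop
  have hcont' : Continuous fun θ => (Complex.exp (t₀ * ℓ θ) * ℓ θ) • G θ := by fun_prop
  refine (intervalIntegral.hasDerivAt_integral_of_dominated_loc_of_deriv_le
    (F := fun t θ => Complex.exp (t * ℓ θ) • G θ)
    (F' := fun t θ => (Complex.exp (t * ℓ θ) * ℓ θ) • G θ)
    (bound := fun _ => Real.exp ((‖t₀‖ + 1) * L) * L * N)
    (Metric.ball_mem_nhds t₀ one_pos) (Eventually.of_forall fun t =>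
      (hcont t).aestronglyMeasurable) ((hcont t₀).intervalIntegrable _ _)
    hcont'.aestronglyMeasurable (Eventually.of_forall fun θ hθ t ht => ?_)
    intervalIntegrable_const (Eventually.of_forall fun θ hθ t ht => ?_)).2.differentiableAt
  · have h1 := hL θ (Set.uIoc_subset_uIcc hθ)
    have h2 := hN θ (Set.uIoc_subset_uIcc hθ)
    have h3 : 0 ≤ L := (norm_nonneg _).trans h1
    have h4 : ‖t‖ ≤ ‖t₀‖ + 1 := by
      have := norm_le_norm_add_norm_sub' t t₀
      rw [mem_ball_iff_norm] at ht
      linarith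
    rw [norm_smul, norm_mul, Complex.norm_exp]
    gcongr
    calc (t * ℓ θ).re ≤ ‖t * ℓ θ‖ := Complex.re_le_norm _
      _ = ‖t‖ * ‖ℓ θ‖ := norm_mul _ _
      _ ≤ _ := by gcongr
  · have : HasDerivAt (fun t => Complex.exp (t * ℓ θ)) (Complex.exp (t * ℓ θ) * ℓ θ) t := by
      simpa using ((hasDerivAt_id t).mul_const (ℓ θ)).cexp
    exact this.smul_const _

theorem mul_resolvent_eq {A : Type*} [NormedRing A] [NormedAlgebra ℂ A] {a : A} {z : ℂ}
    (hz : z ∉ spectrum ℂ a) :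
    a * resolvent a z = z • resolvent a z - 1 ∧ resolvent a z * a = z • resolvent a z - 1 := by
  have h : IsUnit (algebraMap ℂ A z - a) := not_not.1 hz
  have h1 := Ring.mul_inverse_cancel _ h
  have h2 := Ring.inverse_mul_cancel _ h
  rw [sub_mul, ← Algebra.smul_def] at h1
  rw [mul_sub, ← Algebra.commutes, ← Algebra.smul_def] at h2
  exact ⟨by rw [resolvent, ← h1]; abel, by rw [resolvent, ← h2]; abel⟩

theorem mul_circleIntegral {A : Type*} [NormedRing A] [NormedAlgebra ℂ A] [CompleteSpace A]
    (a : A) {f : ℂ → A} {c : ℂ} {r : ℝ} (hf : CircleIntegrable f c r) :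
    a * (∮ z in C(c, r), f z) = ∮ z in C(c, r), a * f z := by
  have := (ContinuousLinearMap.mul ℂ A a).intervalIntegral_comp_comm hf.out
  simpa [circleIntegral] using this.symm

theorem circleIntegral_mul {A : Type*} [NormedRing A] [NormedAlgebra ℂ A] [CompleteSpace A]
    (a : A) {f : ℂ → A} {c : ℂ} {r : ℝ} (hf : CircleIntegrable f c r) :
    (∮ z in C(c, r), f z) * a = ∮ z in C(c, r), f z * a := by
  have := ((ContinuousLinearMap.mul ℂ A).flip a).intervalIntegral_comp_comm hf.out
  simpa [circleIntegral] using this.symm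

theorem exists_mul_eq_self_of_isolated {A : Type*} [NormedRing A] [NormedAlgebra ℂ A]
    [CompleteSpace A]
    {u : Aˣ} {M C s : ℝ} (hs0 : 0 < s) (hs1 : s < 1 / 2)
    (hpow : ∀ n : ℕ, ‖(u : A) ^ n‖ ≤ M)
    (hinv : ∀ n : ℕ, ‖((u⁻¹ : Aˣ) : A) ^ n‖ ≤ C * Real.exp ((n : ℝ) ^ s))
    (h1 : (1 : ℂ) ∈ spectrum ℂ (u : A))
    (hiso : ∃ r > 0, ∀ z ∈ spectrum ℂ (u : A), ‖z - 1‖ < r → z = 1) :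
    ∃ P : A, P ≠ 0 ∧ u * P = P := by
  obtain ⟨r₀, hr₀, hiso⟩ := hiso
  set R : ℂ → A := resolvent (u : A) with hR
  have hnot : ∀ z : ℂ, z ≠ 1 → ‖z - 1‖ < r₀ → z ∉ spectrum ℂ (u : A) :=
    fun z hz hz' hmem => hz (hiso z hmem hz')
  have hRd : ∀ z : ℂ, z ≠ 1 → ‖z - 1‖ < r₀ → DifferentiableAt ℂ R z := fun z hz hz' =>
    (spectrum.hasDerivAt_resolvent_const_left (not_not.1 (hnot z hz hz'))).differentiableAt
  have hslit : ∀ z : ℂ, ‖z - 1‖ < 1 → z ∈ Complex.slitPlane := fun z hz =>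
    Complex.ball_one_subset_slitPlane (by rwa [mem_ball_iff_norm])
  have hEd : ∀ t z : ℂ, ‖z - 1‖ < 1 →
      DifferentiableAt ℂ (fun z => Complex.exp (t * Complex.log z)) z :=
    fun t z hz => ((Complex.differentiableAt_log (hslit z hz)).const_mul t).cexp
  set ρ := min r₀ 1 with hρ
  have hρ0 : 0 < ρ := by positivity
  set W : ℝ → ℂ → A := fun r t => ∮ z in C(1, r), Complex.exp (t * Complex.log z) • R z with hW
  have hsph : ∀ r, 0 < r → r < ρ → ∀ z ∈ Metric.sphere (1 : ℂ) r,
      z ≠ 1 ∧ ‖z - 1‖ < r₀ ∧ ‖z - 1‖ < 1 := by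
    intro r hr hrρ z hz
    rw [mem_sphere_iff_norm] at hz
    refine ⟨?_, ?_, ?_⟩
    · rintro rfl
      simp at hz
      exact hr.ne hz
    · rw [hz]; exact hrρ.trans_le (min_le_left _ _)
    · rw [hz]; exact hrρ.trans_le (min_le_right _ _)
  have hRc : ∀ r, 0 < r → r < ρ → ContinuousOn R (Metric.sphere 1 r) := fun r hr hrρ z hz =>
    (hRd z (hsph r hr hrρ z hz).1 (hsph r hr hrρ z hz).2.1).continuousAt.continuousWithinAt
  have hEc : ∀ t r, 0 < r → r < ρ →
      ContinuousOn (fun z => Complex.exp (t * Complex.log z)) (Metric.sphere 1 r) :=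
    fun t r hr hrρ z hz => (hEd t z (hsph r hr hrρ z hz).2.2).continuousAt.continuousWithinAt
  have hWind : ∀ r r', 0 < r → r ≤ r' → r' < ρ → ∀ t, W r' t = W r t := by
    intro r r' hr hrr' hr' t
    have hd : ∀ z : ℂ, z ≠ 1 → ‖z - 1‖ < ρ →
        DifferentiableAt ℂ (fun z => Complex.exp (t * Complex.log z) • R z) z := fun z hz hz' =>
      (hEd t z (hz'.trans_le (min_le_right _ _))).smul (hRd z hz (hz'.trans_le (min_le_left _ _)))
    refine Complex.circleIntegral_eq_of_differentiable_on_annulus_off_countable hr hrr'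
      Set.countable_empty ?_ ?_
    · rintro z ⟨hz, hz'⟩
      rw [mem_closedBall_iff_norm] at hz
      refine (hd z ?_ (by linarith)).continuousAt.continuousWithinAt
      rintro rfl
      simp [hr] at hz'
    · rintro z ⟨⟨hz, hz'⟩, -⟩
      rw [mem_ball_iff_norm] at hz
      refine hd z ?_ (by linarith)
      rintro rfl
      simp [hr.le] at hz'
  set r := ρ / 2 with hr
  have hr0 : 0 < r := by positivity
  have hrρ : r < ρ := by rw [hr]; linarith
  have hmem : ∀ θ, circleMap 1 r θ ∈ Metric.sphere (1 : ℂ) r := circleMap_mem_sphere _ hr0.le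
  have hWdiff : Differentiable ℂ (W r) := by
    have hℓ : Continuous fun θ => Complex.log (circleMap 1 r θ) := by
      refine (continuous_circleMap _ _).clog fun θ => hslit _ (hsph r hr0 hrρ _ (hmem θ)).2.2
    have hG : Continuous fun θ => deriv (circleMap 1 r) θ • R (circleMap 1 r θ) := by
      refine Continuous.smul ?_ ((hRc r hr0 hrρ).comp_continuous (continuous_circleMap _ _) hmem)
      exact ((continuous_circleMap 0 r).mul continuous_const).congr fun θ =>
        (deriv_circleMap 1 r θ).symm
    have := differentiable_intervalIntegral_exp_smul (a := 0) (b := 2 * Real.pi) hℓ hG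
    simpa only [hW, circleIntegral, smul_comm (deriv (circleMap 1 r) _)] using this
  have hWtype : ∀ ε > 0, ∃ B, ∀ t, ‖W r t‖ ≤ B * Real.exp (ε * ‖t‖) := by
    intro ε hε
    have hlog : ContinuousAt Complex.log 1 := continuousAt_clog (by simp)
    obtain ⟨δ, hδ, hlogδ⟩ := Metric.continuousAt_iff.1 hlog ε hε
    set r₁ := min r (δ / 2) with hr₁
    have hr₁0 : 0 < r₁ := by positivity
    have hr₁r : r₁ ≤ r := min_le_left _ _
    obtain ⟨N, hN⟩ := (isCompact_sphere (1 : ℂ) r₁).exists_bound_of_continuousOn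
      (hRc r₁ hr₁0 (hr₁r.trans_lt hrρ))
    refine ⟨2 * Real.pi * r₁ * N, fun t => ?_⟩
    rw [hWind r₁ r hr₁0 hr₁r hrρ t]
    refine (circleIntegral.norm_integral_le_of_norm_le_const (C := Real.exp (ε * ‖t‖) * N)
      hr₁0.le fun z hz => ?_).trans (le_of_eq (by ring))
    rw [norm_smul, Complex.norm_exp]
    have hz' : ‖Complex.log z‖ ≤ ε := by
      have := hlogδ (x := z) (by
        rw [mem_sphere_iff_norm] at hz
        rw [dist_eq_norm, hz]
        exact (min_le_right _ _).trans_lt (by linarith))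
      simpa using this.le
    gcongr
    · calc (t * Complex.log z).re ≤ ‖t * Complex.log z‖ := Complex.re_le_norm _
        _ = ‖Complex.log z‖ * ‖t‖ := by rw [norm_mul, mul_comm]
        _ ≤ _ := by gcongr
    · exact hN z hz
  have hint : ∀ t, CircleIntegrable (fun z => Complex.exp (t * Complex.log z) • R z) 1 r := fun t =>
    ContinuousOn.circleIntegrable hr0.le ((hEc t r hr0 hrρ).smul (hRc r hr0 hrρ))
  have hstep : ∀ t, W r (t + 1) = u * W r t := by
    intro t
    have hzero : (∮ z in C(1, r), Complex.exp (t * Complex.log z) • (1 : A)) = 0 := by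
      have hd : ∀ z : ℂ, ‖z - 1‖ < 1 →
          DifferentiableAt ℂ (fun z => Complex.exp (t * Complex.log z) • (1 : A)) z :=
        fun z hz => (hEd t z hz).smul_const _
      have hr1 : r < 1 := hrρ.trans_le (min_le_right _ _)
      refine Complex.circleIntegral_eq_zero_of_differentiable_on_off_countable hr0.le
        Set.countable_empty (fun z hz => ?_) (fun z hz => ?_)
      · rw [mem_closedBall_iff_norm] at hz
        exact (hd z (by linarith)).continuousAt.continuousWithinAt
      · exact hd z ((mem_ball_iff_norm.1 hz.1).trans hr1)
    have hint1 : CircleIntegrable (fun z => Complex.exp (t * Complex.log z) • (1 : A)) 1 r :=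
      ContinuousOn.circleIntegrable hr0.le ((hEc t r hr0 hrρ).smul continuousOn_const)
    rw [← sub_zero (W r (t + 1)), ← hzero, mul_circleIntegral _ (hint t),
      ← circleIntegral.integral_sub (hint _) hint1]
    refine circleIntegral.integral_congr hr0.le fun z hz => ?_
    obtain ⟨hz1, hz2, hz3⟩ := hsph r hr0 hrρ z hz
    have hz0 : z ≠ 0 := Complex.slitPlane_ne_zero (hslit z hz3)
    rw [mul_smul_comm, (mul_resolvent_eq (hnot z hz1 hz2)).1, smul_sub, add_mul, one_mul,
      Complex.exp_add, Complex.exp_log hz0, mul_smul]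
  have hstepn : ∀ (n : ℕ) t, W r (t + n) = (u : A) ^ n * W r t := by
    intro n t
    induction n with
    | zero => simp
    | succ n ih => rw [Nat.cast_succ, ← add_assoc, hstep, ih, pow_succ', mul_assoc]
  have hstepneg : ∀ (n : ℕ) t, W r t = ((u⁻¹ : Aˣ) : A) ^ n * W r (t + n) := by
    intro n t
    rw [hstepn, ← mul_assoc, ← Units.val_pow_eq_pow_val, ← Units.val_pow_eq_pow_val,
      ← Units.val_mul, inv_pow, inv_mul_cancel, Units.val_one, one_mul]
  obtain ⟨N, hN⟩ := (isCompact_Icc (a := (0 : ℝ)) (b := 1)).exists_bound_of_continuousOn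
    (f := fun x : ℝ => W r x) (hWdiff.continuous.comp Complex.continuous_ofReal).continuousOn
  have hconst : W r 1 = W r 0 := by
    refine eq_of_subexponential (M := M * N) (D := C * N) (K := 1) hs0 hs1 zero_le_one hWdiff hWtype
      (fun x hx => ?_) (fun x hx => ?_) 1 0
    · have h := hstepn ⌊x⌋₊ ((x - ⌊x⌋₊ : ℝ) : ℂ)
      rw [Complex.ofReal_sub, Complex.ofReal_natCast, sub_add_cancel] at h
      rw [h]
      refine (norm_mul_le _ _).trans ?_
      gcongr
      · exact (norm_nonneg _).trans (hpow 0)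
      · exact hpow _
      · have := hN (x - ⌊x⌋₊) ⟨by linarith [Nat.floor_le hx], by linarith [Nat.lt_floor_add_one x]⟩
        simpa using this
    · have h := hstepneg ⌈x⌉₊ (-x)
      have h2 : ((⌈x⌉₊ : ℕ) : ℝ) ≤ 1 + x := by linarith [Nat.ceil_lt_add_one hx]
      have hC : 0 ≤ C := nonneg_of_mul_nonneg_left ((norm_nonneg _).trans (hinv 0)) (Real.exp_pos _)
      rw [h, one_mul, mul_right_comm]
      refine (norm_mul_le _ _).trans ?_
      gcongr
      · exact (hinv _).trans (by gcongr)
      · have := hN (-x + ⌈x⌉₊) ⟨by linarith [Nat.le_ceil x], by linarith⟩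
        simpa using this
  refine ⟨W r 0, fun hP => ?_, ?_⟩
  swap
  · rw [← hstep, zero_add, hconst]
  have hP' : (∮ z in C(1, r), R z) = 0 := by simpa [hW] using hP
  have hRint : CircleIntegrable R 1 r := by simpa using hint 0
  have hne : ∀ z ∈ Metric.sphere (1 : ℂ) r, z - 1 ≠ 0 := fun z hz =>
    sub_ne_zero.2 (hsph r hr0 hrρ z hz).1
  have hic : ContinuousOn (fun z : ℂ => (z - 1)⁻¹) (Metric.sphere 1 r) :=
    (continuousOn_id.sub continuousOn_const).inv₀ hne
  have hBint : CircleIntegrable (fun z => (z - 1)⁻¹ • R z) 1 r :=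
    ContinuousOn.circleIntegrable hr0.le (hic.smul (hRc r hr0 hrρ))
  have hBint1 : CircleIntegrable (fun z => (z - 1)⁻¹ • (1 : A)) 1 r :=
    ContinuousOn.circleIntegrable hr0.le (hic.smul continuousOn_const)
  set B := ∮ z in C(1, r), (z - 1)⁻¹ • R z with hB
  have hval : (∮ z in C(1, r), R z - (z - 1)⁻¹ • (1 : A)) =
      -((2 * Real.pi * Complex.I) • (1 : A)) := by
    rw [circleIntegral.integral_sub hRint hBint1, hP', circleIntegral.integral_smul_const,
      circleIntegral.integral_sub_center_inv _ hr0.ne', zero_sub]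
  have hleft : (↑u - 1) * B = -((2 * Real.pi * Complex.I) • (1 : A)) := by
    rw [mul_circleIntegral _ hBint, ← hval]
    refine circleIntegral.integral_congr hr0.le fun z hz => ?_
    obtain ⟨hz1, hz2, hz3⟩ := hsph r hr0 hrρ z hz
    rw [mul_smul_comm, sub_mul, one_mul, (mul_resolvent_eq (hnot z hz1 hz2)).1]
    rw [show z • R z - 1 - R z = (z - 1) • R z - 1 by rw [sub_smul, one_smul]; abel, smul_sub,
      smul_smul, inv_mul_cancel₀ (hne z hz), one_smul]
  have hright : B * (↑u - 1) = -((2 * Real.pi * Complex.I) • (1 : A)) := by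
    rw [circleIntegral_mul _ hBint, ← hval]
    refine circleIntegral.integral_congr hr0.le fun z hz => ?_
    obtain ⟨hz1, hz2, hz3⟩ := hsph r hr0 hrρ z hz
    rw [smul_mul_assoc, mul_sub, mul_one, (mul_resolvent_eq (hnot z hz1 hz2)).2]
    rw [show z • R z - 1 - R z = (z - 1) • R z - 1 by rw [sub_smul, one_smul]; abel, smul_sub,
      smul_smul, inv_mul_cancel₀ (hne z hz), one_smul]
  have hc : (2 * Real.pi * Complex.I) ≠ 0 := Complex.two_pi_I_ne_zero
  refine h1 ((Units.isUnit (⟨algebraMap ℂ A 1 - u, (2 * Real.pi * Complex.I)⁻¹ • B, ?_, ?_⟩ : Aˣ)))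
  · rw [map_one, mul_smul_comm, ← neg_sub, neg_mul, hleft, neg_neg, smul_smul, inv_mul_cancel₀ hc,
      one_smul]
  · rw [map_one, smul_mul_assoc, ← neg_sub, mul_neg, hright, neg_neg, smul_smul,
      inv_mul_cancel₀ hc, one_smul]

theorem Set.Countable.exists_isolated_of_isClosed {K : Set ℂ} (hK : K.Countable)
    (hcl : IsClosed K) (hne : K.Nonempty) :
    ∃ x ∈ K, ∃ r > 0, ∀ z ∈ K, ‖z - x‖ < r → z = x := by
  by_contra! h
  have hp : Perfect K := by
    refine ⟨hcl, preperfect_iff_nhds.2 fun x hx U hU => ?_⟩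
    obtain ⟨r, hr, hrU⟩ := Metric.mem_nhds_iff.1 hU
    obtain ⟨z, hz, hzr, hzx⟩ := h x hx r hr
    exact ⟨z, ⟨hrU (by simpa [dist_eq_norm] using hzr), hz⟩, hzx⟩
  obtain ⟨f, hf, -, hinj⟩ := hp.exists_nat_bool_injection hne
  have := (hK.mono hf).to_subtype
  have h2 : Countable (ℕ → Bool) :=
    Function.Injective.countable (f := Set.rangeFactorization f)
      fun a b hab => hinj (congrArg Subtype.val hab)
  rw [← Cardinal.mk_le_aleph0_iff] at h2
  exact absurd h2 (by simp [Cardinal.aleph0_lt_continuum])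

section

variable {A : Type*} [NormedRing A] [NormedAlgebra ℂ A] [CompleteSpace A]

theorem norm_le_one_of_mem_spectrum_of_pow_le {a : A} {k : ℂ} (hk : k ∈ spectrum ℂ a)
    {C s : ℝ} (hs0 : 0 < s) (hs1 : s < 1)
    (h : ∀ n : ℕ, ‖a ^ n‖ ≤ C * Real.exp ((n : ℝ) ^ s)) : ‖k‖ ≤ 1 := by
  by_contra! hk1
  have hl : 0 < Real.log ‖k‖ := Real.log_pos hk1
  obtain ⟨B, hB⟩ := exists_mul_rpow_le_mul_add 1 hs0.le hs1 (half_pos hl)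
  have hC : 0 ≤ C := by
    have := (norm_nonneg _).trans (h 0)
    exact nonneg_of_mul_nonneg_left this (Real.exp_pos _)
  have key : ∀ n : ℕ, Real.exp (Real.log ‖k‖ / 2) ^ n ≤ C * Real.exp B * ‖(1 : A)‖ := by
    intro n
    have h1 : ‖k ^ n‖ ≤ ‖a ^ n‖ * ‖(1 : A)‖ :=
      spectrum.norm_le_norm_mul_of_mem (spectrum.pow_mem_pow a n hk)
    have h2 : ‖k ^ n‖ = Real.exp (Real.log ‖k‖ / 2 * n) * Real.exp (Real.log ‖k‖ / 2 * n) := by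
      rw [← Real.exp_add, norm_pow, ← Real.exp_log (zero_lt_one.trans hk1), ← Real.exp_nat_mul]
      rw [Real.log_exp]; ring_nf
    have h3 : ((n : ℝ)) ^ s ≤ Real.log ‖k‖ / 2 * n + B := by
      refine le_trans ?_ (hB n n.cast_nonneg)
      rw [one_mul]
      exact Real.rpow_le_rpow n.cast_nonneg (by linarith) hs0.le
    have h4 : ‖k ^ n‖ ≤ C * (Real.exp (Real.log ‖k‖ / 2 * n) * Real.exp B) * ‖(1 : A)‖ := by
      refine h1.trans (mul_le_mul_of_nonneg_right ((h n).trans ?_) (norm_nonneg _))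
      rw [← Real.exp_add]
      exact mul_le_mul_of_nonneg_left (Real.exp_le_exp.2 h3) hC
    rw [h2] at h4
    rw [← Real.exp_nat_mul, mul_comm]
    refine le_of_mul_le_mul_left ?_ (Real.exp_pos (Real.log ‖k‖ / 2 * n))
    linarith
  have ht : Tendsto (fun n : ℕ => Real.exp (Real.log ‖k‖ / 2) ^ n) atTop atTop :=
    tendsto_pow_atTop_atTop_of_one_lt (by rw [Real.one_lt_exp_iff]; linarith)
  obtain ⟨n, hn⟩ := (ht.eventually_gt_atTop (C * Real.exp B * ‖(1 : A)‖)).exists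
  exact absurd (key n) (not_le.2 hn)

theorem exists_mul_eq_smul_of_countable_spectrum [Nontrivial A] {u : Aˣ} {M C s : ℝ}
    (hs0 : 0 < s) (hs1 : s < 1/2) (hpow : ∀ n : ℕ, ‖(u : A) ^ n‖ ≤ M)
    (hinv : ∀ n : ℕ, ‖((u⁻¹ : Aˣ) : A) ^ n‖ ≤ C * Real.exp ((n : ℝ) ^ s))
    (hu : (spectrum ℂ (u : A)).Countable) :
    ∃ μ : ℂ, ‖μ‖ = 1 ∧ ∃ P : A, P ≠ 0 ∧ u * P = μ • P := by
  obtain ⟨μ, hμ, r, hr, hiso⟩ :=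
    hu.exists_isolated_of_isClosed (spectrum.isClosed _) (spectrum.nonempty _)
  have hμ0 : μ ≠ 0 := fun h => by
    subst h
    exact (spectrum.zero_notMem_iff ℂ).2 u.isUnit hμ
  have hM : 0 ≤ M := (norm_nonneg _).trans (hpow 0)
  have hle : ‖μ‖ ≤ 1 := by
    refine norm_le_one_of_mem_spectrum_of_pow_le hμ (C := M) hs0 (by linarith) fun n =>
      (hpow n).trans (le_mul_of_one_le_right hM (Real.one_le_exp (by positivity)))
  have hge : ‖μ⁻¹‖ ≤ 1 := by
    refine norm_le_one_of_mem_spectrum_of_pow_le (a := ((u⁻¹ : Aˣ) : A)) (C := C) (s := s) ?_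
      hs0 (by linarith) hinv
    have := (spectrum.inv_mem_iff (r := Units.mk0 μ hμ0) (a := u)).1 hμ
    simpa using this
  have h1 : ‖μ‖ = 1 := by
    refine le_antisymm hle ?_
    rw [norm_inv] at hge
    exact (inv_le_one₀ (norm_pos_iff.2 hμ0)).1 hge
  refine ⟨μ, h1, ?_⟩
  set v : Aˣ := (Units.mk0 μ hμ0)⁻¹ • u with hv
  have hvc : (v : A) = μ⁻¹ • (u : A) := by
    rw [hv]; simp [Units.val_smul, Units.smul_def]
  have hvi : ((v⁻¹ : Aˣ) : A) = μ • ((u⁻¹ : Aˣ) : A) := by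
    rw [hv]; simp [Units.smul_def]
  have hsp : ∀ z, z ∈ spectrum ℂ (v : A) ↔ μ * z ∈ spectrum ℂ (u : A) := by
    intro z
    have : (u : A) = (Units.mk0 μ hμ0) • (v : A) := by
      rw [hvc]; simp [Units.smul_def, smul_smul, hμ0]
    rw [this]
    exact (spectrum.smul_mem_smul_iff (r := Units.mk0 μ hμ0)).symm
  obtain ⟨P, hP, hPe⟩ := exists_mul_eq_self_of_isolated (u := v) (M := M) (C := C) hs0 hs1
    (fun n => by simpa [hvc, smul_pow, norm_smul, h1] using hpow n)
    (fun n => by simpa [hvi, smul_pow, norm_smul, h1] using hinv n)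
    ((hsp 1).2 (by simpa using hμ))
    ⟨r, hr, fun z hz hzr => by
      have := hiso (μ * z) ((hsp z).1 hz) (by
        rw [show μ * z - μ = μ * (z - 1) by ring, norm_mul, h1, one_mul]; exact hzr)
      exact mul_left_cancel₀ hμ0 (by rw [this, mul_one])⟩
  refine ⟨P, hP, ?_⟩
  have h2 : (u : A) = μ • (v : A) := by rw [hvc, smul_smul, mul_inv_cancel₀ hμ0, one_smul]
  rw [h2, smul_mul_assoc, hPe]

end

theorem exists_eigenvector_of_countable_spectrum {X : Type*} [NormedAddCommGroup X]
    [NormedSpace ℂ X] [CompleteSpace X] [Nontrivial X] {T : (X →L[ℂ] X)ˣ} {M C s : ℝ}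
    (hs0 : 0 < s) (hs1 : s < 1 / 2) (hpow : ∀ n : ℕ, ‖(T : X →L[ℂ] X) ^ n‖ ≤ M)
    (hinv : ∀ n : ℕ, ‖((T⁻¹ : (X →L[ℂ] X)ˣ) : X →L[ℂ] X) ^ n‖ ≤ C * Real.exp ((n : ℝ) ^ s))
    (hT : (spectrum ℂ (T : X →L[ℂ] X)).Countable) :
    ∃ μ : ℂ, ‖μ‖ = 1 ∧ ∃ x : X, x ≠ 0 ∧ (T : X →L[ℂ] X) x = μ • x := by
  obtain ⟨μ, hμ, P, hP, hPe⟩ := exists_mul_eq_smul_of_countable_spectrum hs0 hs1 hpow hinv hT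
  obtain ⟨x, hx⟩ : ∃ x, P x ≠ 0 := by
    by_contra! h
    exact hP (ContinuousLinearMap.ext h)
  refine ⟨μ, hμ, P x, hx, ?_⟩
  rw [← mul_apply_eq_comp, hPe, smul_apply]

section

variable {H : Type*} [NormedAddCommGroup H] [InnerProductSpace ℂ H]

namespace ContinuousLinearMap

/-- The restriction of a bounded operator to an invariant subspace. -/
noncomputable def restrictInvariant (A : H →L[ℂ] H) (N : Submodule ℂ H) (h : ∀ x ∈ N, A x ∈ N) :
    N →L[ℂ] N :=
  (A ∘L N.subtypeL).codRestrict N fun x => h x x.2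

theorem coe_restrictInvariant_apply {A : H →L[ℂ] H} {N : Submodule ℂ H}
    (h : ∀ x ∈ N, A x ∈ N) (x : N) : (A.restrictInvariant N h x : H) = A x := rfl

theorem coe_restrictInvariant_pow_apply {A : H →L[ℂ] H} {N : Submodule ℂ H}
    (h : ∀ x ∈ N, A x ∈ N) (n : ℕ) (x : N) :
    ((A.restrictInvariant N h ^ n) x : H) = (A ^ n) x := by
  induction n generalizing x with
  | zero => simp
  | succ n ih =>
    rw [pow_succ, pow_succ, mul_apply_eq_comp, mul_apply_eq_comp, ih, coe_restrictInvariant_apply]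

theorem norm_restrictInvariant_pow_le {A : H →L[ℂ] H} {N : Submodule ℂ H}
    (h : ∀ x ∈ N, A x ∈ N) (n : ℕ) : ‖A.restrictInvariant N h ^ n‖ ≤ ‖A ^ n‖ :=
  opNorm_le_bound _ (norm_nonneg _) fun x => by
    rw [Submodule.coe_norm, coe_restrictInvariant_pow_apply]
    exact (A ^ n).le_opNorm x

theorem eq_zero_of_apply_eq_self_of_mem_closure_range {S : H →L[ℂ] H} {M : ℝ}
    (hS : ∀ n : ℕ, ‖S ^ n‖ ≤ M) {v : H} (hv : S v = v)
    (hcl : v ∈ ((S - 1 : H →L[ℂ] H) : H →ₗ[ℂ] H).range.topologicalClosure) : v = 0 := by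
  have hM : 0 ≤ M := (norm_nonneg _).trans (hS 0)
  have hvn : ∀ n : ℕ, (S ^ n) v = v := fun n => by
    induction n with
    | zero => simp
    | succ n ih => rw [pow_succ, mul_apply_eq_comp, hv, ih]
  have hb : ∀ k (x : H), ‖(S ^ k) x‖ ≤ M * ‖x‖ := fun k x => (S ^ k).le_of_opNorm_le (hS k) x
  by_contra h0
  have hv0 : 0 < ‖v‖ := norm_pos_iff.2 h0
  obtain ⟨ε, hε, hεv⟩ : ∃ ε > 0, M * ε < ‖v‖ := by
    refine ⟨‖v‖ / (M + 1), by positivity, ?_⟩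
    rw [mul_div_assoc', div_lt_iff₀ (by positivity)]
    nlinarith
  obtain ⟨_, ⟨x, rfl⟩, hx⟩ := Metric.mem_closure_iff.1 hcl ε hε
  rw [dist_eq_norm] at hx
  have key : ∀ n : ℕ, n * ‖v‖ ≤ n * (M * ε) + 2 * (M * ‖x‖) := by
    intro n
    have h1 : (n : ℂ) • v = ∑ k ∈ Finset.range n, (S ^ k) (v - (S - 1 : H →L[ℂ] H) x) +
        ((S ^ n) x - (S ^ 0) x) := by
      rw [← Finset.sum_range_sub (fun k => (S ^ k) x), ← Finset.sum_add_distrib]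
      have : ∀ k ∈ Finset.range n, (S ^ k) (v - (S - 1 : H →L[ℂ] H) x) +
          ((S ^ (k + 1)) x - (S ^ k) x) = v := fun k _ => by
        rw [map_sub, hvn, pow_succ, mul_apply_eq_comp, sub_apply, map_sub]
        simp
      rw [Finset.sum_congr rfl this]
      simp [Nat.cast_smul_eq_nsmul]
    have h2 : ‖(n : ℂ) • v‖ = n * ‖v‖ := by simp [norm_smul]
    rw [← h2, h1]
    refine (norm_add_le _ _).trans (add_le_add ?_ ?_)
    · refine (norm_sum_le_of_le _ fun k _ => (hb k _).trans
        (mul_le_mul_of_nonneg_left hx.le hM)).trans_eq (by simp)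
    · exact (norm_sub_le _ _).trans (by linarith [hb n x, hb 0 x])
  obtain ⟨n, hn⟩ := exists_nat_gt (2 * (M * ‖x‖) / (‖v‖ - M * ε))
  rw [div_lt_iff₀ (by linarith)] at hn
  linarith [key n]

/-- The eigenvectors of `A` belonging to unimodular eigenvalues. -/
def unimodularEigenvectors (A : H →L[ℂ] H) : Set H :=
  {u | ∃ μ : ℂ, ‖μ‖ = 1 ∧ A u = μ • u}

theorem norm_le_mul_norm_pow_apply_of_dense_span {A : H →L[ℂ] H} {M : ℝ}
    (hA : ∀ n : ℕ, ‖A ^ n‖ ≤ M)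
    (hd : (Submodule.span ℂ (unimodularEigenvectors A)).topologicalClosure = ⊤) (k : ℕ) (x : H) :
    ‖x‖ ≤ M * ‖(A ^ k) x‖ := by
  choose μ hμ hμA using fun u : unimodularEigenvectors A => u.2
  let g : unimodularEigenvectors A → Circle := fun u => ⟨μ u, mem_sphere_zero_iff_norm.2 (hμ u)⟩
  obtain ⟨U, hU, hUg⟩ := mapClusterPt_iff_ultrafilter.1 (mapClusterPt_one_atTop_pow g)
  have hlim : ∀ x ∈ Submodule.span ℂ (unimodularEigenvectors A),
      Tendsto (fun n : ℕ => (A ^ n) x) U (𝓝 x) := by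
    intro x hx
    induction hx using Submodule.span_induction with
    | mem u hu =>
      have h1 : Tendsto (fun n : ℕ => μ ⟨u, hu⟩ ^ n) U (𝓝 1) := by
        exact (continuous_subtype_val.tendsto _).comp (tendsto_pi_nhds.1 hUg ⟨u, hu⟩)
      have h2 : ∀ n : ℕ, (A ^ n) u = μ ⟨u, hu⟩ ^ n • u := fun n => by
        induction n with
        | zero => simp
        | succ n ih =>
          rw [pow_succ', mul_apply_eq_comp, ih, map_smul, hμA ⟨u, hu⟩, smul_smul, pow_succ]
      simpa [h2] using h1.smul_const u
    | zero => simp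
    | add u v _ _ hu hv => simpa using hu.add hv
    | smul c u _ hu => simpa using hu.const_smul c
  have hx : x ∈ closure (Submodule.span ℂ (unimodularEigenvectors A) : Set H) := by
    rw [← Submodule.topologicalClosure_coe, hd]; trivial
  refine closure_minimal (fun y hy => ?_) (isClosed_le continuous_norm
    (continuous_const.mul (A ^ k).continuous.norm)) hx
  refine le_of_tendsto (hlim y hy).norm ((eventually_ge_atTop k).filter_mono hU |>.mono
    fun n hn => ?_)
  rw [← Nat.sub_add_cancel hn, pow_add, mul_apply_eq_comp]
  exact (A ^ (n - k)).le_of_opNorm_le (hA _) _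

theorem exists_eigenvector_mem_of_invariant {T : (H →L[ℂ] H)ˣ} {M C s : ℝ}
    (hs0 : 0 < s) (hs1 : s < 1 / 2) (hpow : ∀ n : ℕ, ‖(T : H →L[ℂ] H) ^ n‖ ≤ M)
    (hinv : ∀ n : ℕ, ‖((T⁻¹ : (H →L[ℂ] H)ˣ) : H →L[ℂ] H) ^ n‖ ≤ C * Real.exp ((n : ℝ) ^ s))
    {N : Submodule ℂ H} [CompleteSpace N] [Nontrivial N]
    (hN : ∀ x ∈ N, (T : H →L[ℂ] H) x ∈ N)
    (hN' : ∀ x ∈ N, ((T⁻¹ : (H →L[ℂ] H)ˣ) : H →L[ℂ] H) x ∈ N)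
    (hT : (spectrum ℂ (restrictInvariant (T : H →L[ℂ] H) N hN)).Countable) :
    ∃ μ : ℂ, ‖μ‖ = 1 ∧ ∃ v ∈ N, v ≠ 0 ∧ (T : H →L[ℂ] H) v = μ • v := by
  have h1 : restrictInvariant _ _ hN * restrictInvariant _ _ hN' = 1 := by
    ext x
    rw [mul_apply_eq_comp, coe_restrictInvariant_apply, coe_restrictInvariant_apply,
      ← mul_apply_eq_comp, T.mul_inv, one_apply_eq_self, one_apply_eq_self]
  have h2 : restrictInvariant _ _ hN' * restrictInvariant _ _ hN = 1 := by
    ext x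
    rw [mul_apply_eq_comp, coe_restrictInvariant_apply, coe_restrictInvariant_apply,
      ← mul_apply_eq_comp, T.inv_mul, one_apply_eq_self, one_apply_eq_self]
  obtain ⟨w, hw, hw'⟩ : ∃ w : (N →L[ℂ] N)ˣ, (w : N →L[ℂ] N) = restrictInvariant _ _ hN ∧
      ((w⁻¹ : (N →L[ℂ] N)ˣ) : N →L[ℂ] N) = restrictInvariant _ _ hN' :=
    ⟨⟨_, _, h1, h2⟩, rfl, rfl⟩
  rw [← hw] at hT
  have hpow' : ∀ n : ℕ, ‖(w : N →L[ℂ] N) ^ n‖ ≤ M := fun n => by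
    rw [hw]
    exact (norm_restrictInvariant_pow_le hN n).trans (hpow n)
  have hinv' : ∀ n : ℕ, ‖((w⁻¹ : (N →L[ℂ] N)ˣ) : N →L[ℂ] N) ^ n‖ ≤ C * Real.exp ((n : ℝ) ^ s) :=
    fun n => by
      rw [hw']
      exact (norm_restrictInvariant_pow_le hN' n).trans (hinv n)
  obtain ⟨μ, hμ, x, hx, hwx⟩ := exists_eigenvector_of_countable_spectrum hs0 hs1 hpow' hinv' hT
  refine ⟨μ, hμ, x, x.2, fun h => hx (Subtype.ext h), ?_⟩
  rw [hw] at hwx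
  rw [← Submodule.coe_smul, ← hwx, coe_restrictInvariant_apply]

variable [CompleteSpace H]

theorem apply_mem_orthogonal_span_of_adjoint_apply {A : H →L[ℂ] H} {E : Set H}
    (hE : ∀ u ∈ E, ∃ a : ℂ, adjoint A u = a • u) {x : H} (hx : x ∈ (Submodule.span ℂ E)ᗮ) :
    A x ∈ (Submodule.span ℂ E)ᗮ := by
  rw [Submodule.mem_orthogonal] at hx ⊢
  intro u hu
  rw [← adjoint_inner_left]
  refine hx _ ?_
  induction hu using Submodule.span_induction with
  | mem u hu =>
    obtain ⟨a, ha⟩ := hE u hu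
    rw [ha]; exact Submodule.smul_mem _ _ (Submodule.subset_span hu)
  | zero => simp
  | add u v _ _ hu hv => rw [map_add]; exact add_mem hu hv
  | smul c u _ hu => rw [map_smul]; exact Submodule.smul_mem _ _ hu

theorem exists_adjoint_apply_eq_smul_of_mul_eq_one {A R : H →L[ℂ] H} (h : A * R = 1)
    {u : H} (hu : ∃ a : ℂ, adjoint A u = a • u) : ∃ a : ℂ, adjoint R u = a • u := by
  obtain ⟨a, ha⟩ := hu
  have hRA : adjoint R (adjoint A u) = u := by
    rw [← comp_apply, ← adjoint_comp]
    change adjoint (A * R) u = u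
    rw [h]
    exact congrArg (· u) (star_one (H →L[ℂ] H))
  rcases eq_or_ne a 0 with rfl | h0
  · refine ⟨0, ?_⟩
    rw [ha, zero_smul, map_zero] at hRA
    rw [← hRA]; simp
  · refine ⟨a⁻¹, ?_⟩
    nth_rewrite 2 [← hRA]
    rw [ha, map_smul, smul_smul, inv_mul_cancel₀ h0, one_smul]

theorem spectrum_restrictInvariant_orthogonal_span_subset {A : H →L[ℂ] H} {E : Set H}
    (hE : ∀ u ∈ E, ∃ a : ℂ, adjoint A u = a • u) :
    spectrum ℂ (A.restrictInvariant (Submodule.span ℂ E)ᗮ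
      fun _ hx => apply_mem_orthogonal_span_of_adjoint_apply hE hx) ⊆ spectrum ℂ A := by
  intro z hz
  by_contra hzA
  rw [spectrum.notMem_iff] at hzA
  obtain ⟨w, hw⟩ := hzA
  refine hz ?_
  have hEw : ∀ u ∈ E, ∃ a : ℂ, adjoint (w : H →L[ℂ] H) u = a • u := fun u hu => by
    obtain ⟨a, ha⟩ := hE u hu
    refine ⟨starRingEnd ℂ z - a, ext_inner_right ℂ fun y => ?_⟩
    rw [adjoint_inner_left, hw]
    simp [Algebra.algebraMap_eq_smul_one, inner_sub_right, inner_smul_right, sub_smul,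
      inner_sub_left, inner_smul_left, ← ha, adjoint_inner_left]
  have hEw' : ∀ u ∈ E, ∃ a : ℂ, adjoint ((w⁻¹ : (H →L[ℂ] H)ˣ) : H →L[ℂ] H) u = a • u :=
    fun u hu => exists_adjoint_apply_eq_smul_of_mul_eq_one w.mul_inv (hEw u hu)
  have hinv := fun x hx => apply_mem_orthogonal_span_of_adjoint_apply (x := x) hEw' hx
  rw [spectrum.mem_resolventSet_iff, isUnit_iff_exists]
  refine ⟨restrictInvariant _ _ hinv, ?_, ?_⟩
  · ext x
    have := congrArg (· (x : H)) w.mul_inv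
    simpa [hw, coe_restrictInvariant_apply, Algebra.algebraMap_eq_smul_one] using this
  · ext x
    have := congrArg (· (x : H)) w.inv_mul
    simpa [hw, coe_restrictInvariant_apply, Algebra.algebraMap_eq_smul_one] using this

theorem mem_closure_range_sub_one_of_orthogonal {S : H →L[ℂ] H} {v : H}
    (h : ∀ u, adjoint S u = u → inner ℂ u v = 0) :
    v ∈ ((S - 1 : H →L[ℂ] H) : H →ₗ[ℂ] H).range.topologicalClosure := by
  rw [← Submodule.orthogonal_orthogonal_eq_closure, Submodule.mem_orthogonal]
  intro u hu
  refine h u (ext_inner_right ℂ fun y => ?_)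
  rw [Submodule.mem_orthogonal'] at hu
  have := hu ((S - 1 : H →L[ℂ] H) y) ⟨y, rfl⟩
  rw [sub_apply, inner_sub_right, sub_eq_zero] at this
  rw [adjoint_inner_left, this]
  simp

theorem orthogonal_span_unimodularEigenvectors_adjoint {T : (H →L[ℂ] H)ˣ} {M C s : ℝ}
    (hs0 : 0 < s) (hs1 : s < 1 / 2) (hpow : ∀ n : ℕ, ‖(T : H →L[ℂ] H) ^ n‖ ≤ M)
    (hinv : ∀ n : ℕ, ‖((T⁻¹ : (H →L[ℂ] H)ˣ) : H →L[ℂ] H) ^ n‖ ≤ C * Real.exp ((n : ℝ) ^ s))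
    (hT : (spectrum ℂ (T : H →L[ℂ] H)).Countable) :
    (Submodule.span ℂ (unimodularEigenvectors (adjoint (T : H →L[ℂ] H))))ᗮ = ⊥ := by
  set E := unimodularEigenvectors (adjoint (T : H →L[ℂ] H)) with hEdef
  by_contra hN
  have hE : ∀ u ∈ E, ∃ a : ℂ, adjoint (T : H →L[ℂ] H) u = a • u :=
    fun u ⟨a, _, ha⟩ => ⟨a, ha⟩
  have hE' : ∀ u ∈ E, ∃ a : ℂ, adjoint ((T⁻¹ : (H →L[ℂ] H)ˣ) : H →L[ℂ] H) u = a • u :=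
    fun u hu => exists_adjoint_apply_eq_smul_of_mul_eq_one T.mul_inv (hE u hu)
  have hNT := fun x hx => apply_mem_orthogonal_span_of_adjoint_apply (x := x) hE hx
  have hNT' := fun x hx => apply_mem_orthogonal_span_of_adjoint_apply (x := x) hE' hx
  have hnt : Nontrivial (Submodule.span ℂ E)ᗮ := Submodule.nontrivial_iff_ne_bot.2 hN
  obtain ⟨μ, hμ, v, hvN, hv0, hTv⟩ := exists_eigenvector_mem_of_invariant hs0 hs1 hpow hinv hNT hNT'
    (hT.mono (spectrum_restrictInvariant_orthogonal_span_subset hE))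
  have hμ0 : μ ≠ 0 := norm_ne_zero_iff.1 (hμ ▸ one_ne_zero)
  refine hv0 (eq_zero_of_apply_eq_self_of_mem_closure_range
    (S := μ⁻¹ • (T : H →L[ℂ] H)) (M := M) (fun n => ?_) ?_
    (mem_closure_range_sub_one_of_orthogonal fun u hu => ?_))
  · simpa [smul_pow, norm_smul, hμ] using hpow n
  · rw [smul_apply, hTv, smul_smul, inv_mul_cancel₀ hμ0, one_smul]
  · refine (Submodule.mem_orthogonal _ _).1 hvN u (Submodule.subset_span
      ⟨starRingEnd ℂ μ, by simpa using hμ, ?_⟩)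
    rw [map_smulₛₗ, smul_apply] at hu
    nth_rewrite 2 [← hu]
    rw [smul_smul, ← map_mul, mul_inv_cancel₀ hμ0, map_one, one_smul]

theorem norm_le_mul_norm_pow_apply_of_countable_spectrum {T : (H →L[ℂ] H)ˣ} {M C s : ℝ}
    (hs0 : 0 < s) (hs1 : s < 1 / 2) (hpow : ∀ n : ℕ, ‖(T : H →L[ℂ] H) ^ n‖ ≤ M)
    (hinv : ∀ n : ℕ, ‖((T⁻¹ : (H →L[ℂ] H)ˣ) : H →L[ℂ] H) ^ n‖ ≤ C * Real.exp ((n : ℝ) ^ s))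
    (hT : (spectrum ℂ (T : H →L[ℂ] H)).Countable) (n : ℕ) (x : H) :
    ‖x‖ ≤ M * ‖((T : H →L[ℂ] H) ^ n) x‖ := by
  have hd := Submodule.topologicalClosure_eq_top_iff.2
    (orthogonal_span_unimodularEigenvectors_adjoint hs0 hs1 hpow hinv hT)
  have hM : 0 ≤ M := (norm_nonneg _).trans (hpow 0)
  have hadj : ∀ n : ℕ, adjoint (T : H →L[ℂ] H) ^ n = adjoint ((T : H →L[ℂ] H) ^ n) := fun n =>
    (star_pow (T : H →L[ℂ] H) n).symm
  have hlow := norm_le_mul_norm_pow_apply_of_dense_span (A := adjoint (T : H →L[ℂ] H)) (M := M)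
    (fun n => by rw [hadj, LinearIsometryEquiv.norm_map]; exact hpow n) hd n
  have hle : ‖((T ^ n)⁻¹ : (H →L[ℂ] H)ˣ).val‖ ≤ M := by
    rw [← LinearIsometryEquiv.norm_map adjoint]
    refine opNorm_le_bound _ hM fun y => (hlow _).trans_eq ?_
    have h1 : adjoint ((T : H →L[ℂ] H) ^ n) * adjoint ((T ^ n)⁻¹ : (H →L[ℂ] H)ˣ).val = 1 := by
      have := congrArg star (T ^ n).inv_mul
      rwa [star_mul, star_one, Units.val_pow_eq_pow_val] at this
    rw [hadj, ← mul_apply_eq_comp, h1, one_apply_eq_self]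
  have h2 : ((T ^ n)⁻¹ : (H →L[ℂ] H)ˣ).val (((T : H →L[ℂ] H) ^ n) x) = x := by
    rw [← Units.val_pow_eq_pow_val, ← mul_apply_eq_comp, Units.inv_mul, one_apply_eq_self]
  nth_rewrite 1 [← h2]
  exact le_of_opNorm_le _ hle _

end ContinuousLinearMap

end

section

variable {H : Type*} [NormedAddCommGroup H] [InnerProductSpace ℂ H]

/-- The Cesàro means of the sesquilinear forms `⟪T ^ k x, T ^ k y⟫` for `k ≤ n`. -/
noncomputable def orbitMean (T : H →L[ℂ] H) (n : ℕ) (x y : H) : ℂ :=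
  ((n : ℂ) + 1)⁻¹ * ∑ k ∈ Finset.range (n + 1), inner ℂ ((T ^ k) x) ((T ^ k) y)

theorem norm_orbitMean_le {T : H →L[ℂ] H} {M : ℝ} (hT : ∀ n : ℕ, ‖T ^ n‖ ≤ M) (n : ℕ)
    (x y : H) : ‖orbitMean T n x y‖ ≤ M ^ 2 * ‖x‖ * ‖y‖ := by
  have hb : ∀ k (x : H), ‖(T ^ k) x‖ ≤ M * ‖x‖ := fun k x => (T ^ k).le_of_opNorm_le (hT k) x
  have hM : 0 ≤ M := (norm_nonneg _).trans (hT 0)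
  have hn : ‖((n : ℂ) + 1)⁻¹‖ = ((n : ℝ) + 1)⁻¹ := by
    rw [norm_inv]; congr 1; exact_mod_cast Complex.norm_natCast (n + 1)
  rw [orbitMean, norm_mul, hn, inv_mul_le_iff₀ (by positivity)]
  refine (norm_sum_le_of_le _ (fun k _ => (norm_inner_le_norm _ _).trans
    (mul_le_mul (hb k x) (hb k y) (norm_nonneg _) (by positivity)))).trans ?_
  simp only [Finset.sum_const, Finset.card_range, nsmul_eq_mul]
  push_cast
  exact le_of_eq (by ring)

theorem tendsto_orbitMean_sub {T : H →L[ℂ] H} {M : ℝ} (hT : ∀ n : ℕ, ‖T ^ n‖ ≤ M) (x y : H) :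
    Tendsto (fun n => orbitMean T n (T x) (T y) - orbitMean T n x y) atTop (𝓝 0) := by
  have hb : ∀ k (x : H), ‖(T ^ k) x‖ ≤ M * ‖x‖ := fun k x => (T ^ k).le_of_opNorm_le (hT k) x
  have hM : 0 ≤ M := (norm_nonneg _).trans (hT 0)
  refine squeeze_zero_norm (a := fun n : ℕ => (2 * (M ^ 2 * ‖x‖ * ‖y‖)) * (1 / ((n : ℝ) + 1)))
    (fun n => ?_)
    (by
      simpa using (tendsto_one_div_add_atTop_nhds_zero_nat (𝕜 := ℝ)).const_mul
        (2 * (M ^ 2 * ‖x‖ * ‖y‖)))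
  have hn : ‖((n : ℂ) + 1)⁻¹‖ = 1 / ((n : ℝ) + 1) := by
    rw [norm_inv, one_div]; congr 1; exact_mod_cast Complex.norm_natCast (n + 1)
  have he : orbitMean T n (T x) (T y) - orbitMean T n x y = ((n : ℂ) + 1)⁻¹ *
      (inner ℂ ((T ^ (n + 1)) x) ((T ^ (n + 1)) y) - inner ℂ ((T ^ 0) x) ((T ^ 0) y)) := by
    rw [orbitMean, orbitMean, ← mul_sub, ← Finset.sum_sub_distrib,
      ← Finset.sum_range_sub (fun k => inner ℂ ((T ^ k) x) ((T ^ k) y))]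
    simp only [pow_succ, mul_apply_eq_comp]
  rw [he, norm_mul, hn, mul_comm]
  refine mul_le_mul_of_nonneg_right ?_ (by positivity)
  have hi : ∀ k, ‖inner ℂ ((T ^ k) x) ((T ^ k) y)‖ ≤ M ^ 2 * ‖x‖ * ‖y‖ := fun k =>
    (norm_inner_le_norm _ _).trans ((mul_le_mul (hb k x) (hb k y) (norm_nonneg _)
      (by positivity)).trans_eq (by ring))
  calc _ ≤ _ := norm_sub_le _ _
    _ ≤ _ := by linarith [hi (n + 1), hi 0]

variable [CompleteSpace H]

theorem exists_positive_conj_eq {T : H →L[ℂ] H} {M : ℝ} (hT : ∀ n : ℕ, ‖T ^ n‖ ≤ M)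
    {c : ℝ} (hc : ∀ (n : ℕ) x, c * ‖x‖ ≤ ‖(T ^ n) x‖) (hc0 : 0 ≤ c) :
    ∃ S : H →L[ℂ] H, S.IsPositive ∧ (∀ x y, inner ℂ (S (T x)) (T y) = inner ℂ (S x) y) ∧
      ∀ x, c ^ 2 * ‖x‖ ^ 2 ≤ RCLike.re (inner ℂ (S x) x) := by
  have hM : 0 ≤ M := (norm_nonneg _).trans (hT 0)
  have hex : ∀ x y, ∃ z, Tendsto (fun n => orbitMean T n x y) (hyperfilter ℕ) (𝓝 z) := by
    intro x y
    obtain ⟨z, -, hz⟩ := (isCompact_closedBall (0 : ℂ) (M ^ 2 * ‖x‖ * ‖y‖)).ultrafilter_le_nhds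
      ((hyperfilter ℕ).map fun n => orbitMean T n x y) (by
        rw [le_principal_iff]
        exact Filter.mem_map.2 (univ_mem' fun n => by
          simpa using norm_orbitMean_le hT n x y))
    exact ⟨z, hz⟩
  choose b hb using hex
  have hbd : ∀ x y, ‖b x y‖ ≤ M ^ 2 * ‖x‖ * ‖y‖ := fun x y =>
    le_of_tendsto (hb x y).norm (Eventually.of_forall fun n => norm_orbitMean_le hT n x y)
  let B : H →L⋆[ℂ] H →L[ℂ] ℂ := LinearMap.mkContinuous₂
    (LinearMap.mk₂'ₛₗ (starRingEnd ℂ) (RingHom.id ℂ) b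
      (fun x x' y => tendsto_nhds_unique (hb _ _) (((hb x y).add (hb x' y)).congr fun n => by
        simp only [orbitMean, map_add, inner_add_left, Finset.sum_add_distrib, mul_add]))
      (fun a x y => tendsto_nhds_unique (hb _ _) (((hb x y).const_mul _).congr fun n => by
        simp only [orbitMean, map_smul, inner_smul_left, ← Finset.mul_sum, mul_left_comm]))
      (fun x y y' => tendsto_nhds_unique (hb _ _) (((hb x y).add (hb x y')).congr fun n => by
        simp only [orbitMean, map_add, inner_add_right, Finset.sum_add_distrib, mul_add]))
      (fun a x y => tendsto_nhds_unique (hb _ _) (((hb x y).const_mul _).congr fun n => by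
        simp only [orbitMean, map_smul, inner_smul_right, ← Finset.mul_sum, mul_left_comm,
          RingHom.id_apply])))
    (M ^ 2) hbd
  have hB : ∀ x y, inner ℂ (InnerProductSpace.continuousLinearMapOfBilin B x) y = b x y :=
    fun x y => InnerProductSpace.continuousLinearMapOfBilin_apply B x y
  have hlow : ∀ x, c ^ 2 * ‖x‖ ^ 2 ≤ (b x x).re ∧ (b x x).im = 0 := by
    intro x
    have hform : ∀ n, orbitMean T n x x =
        ((((n : ℝ) + 1)⁻¹ * ∑ k ∈ Finset.range (n + 1), ‖(T ^ k) x‖ ^ 2 : ℝ) : ℂ) := by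
      intro n
      simp only [orbitMean, inner_self_eq_norm_sq_to_K]
      push_cast
      rfl
    constructor
    · refine ge_of_tendsto (Complex.continuous_re.continuousAt.tendsto.comp (hb x x))
        (Eventually.of_forall fun n => ?_)
      simp only [Function.comp, hform, Complex.ofReal_re]
      rw [le_inv_mul_iff₀ (by positivity)]
      calc ((n : ℝ) + 1) * (c ^ 2 * ‖x‖ ^ 2)
          = ∑ k ∈ Finset.range (n + 1), (c * ‖x‖) ^ 2 := by
            rw [Finset.sum_const, Finset.card_range, nsmul_eq_mul]; push_cast; ring
        _ ≤ _ := Finset.sum_le_sum fun k _ => by gcongr; exact hc k x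
    · refine tendsto_nhds_unique (Complex.continuous_im.continuousAt.tendsto.comp (hb x x))
        (tendsto_const_nhds.congr fun n => ?_)
      simp only [Function.comp, hform, Complex.ofReal_im]
  refine ⟨InnerProductSpace.continuousLinearMapOfBilin B, ?_, fun x y => ?_, fun x => ?_⟩
  · rw [ContinuousLinearMap.isPositive_iff_complex]
    intro x
    rw [hB]
    refine ⟨Complex.ext (by simp) (by simp [(hlow x).2]), ?_⟩
    exact le_trans (by positivity) (hlow x).1
  · rw [hB, hB]
    have h1 := (hb (T x) (T y)).sub (hb x y)
    have h2 := (tendsto_orbitMean_sub hT x y).mono_left (Nat.hyperfilter_le_atTop)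
    exact sub_eq_zero.1 (tendsto_nhds_unique h1 h2)
  · rw [hB]; exact (hlow x).1

theorem exists_similar_isometry_of_bounded_orbits {T : H →L[ℂ] H} {M : ℝ}
    (hT : ∀ n : ℕ, ‖T ^ n‖ ≤ M)
    {c : ℝ} (hc : ∀ (n : ℕ) x, c * ‖x‖ ≤ ‖(T ^ n) x‖) (hc0 : 0 < c) :
    ∃ L : H ≃L[ℂ] H, ∀ x, ‖L.symm (T (L x))‖ = ‖x‖ := by
  obtain ⟨S, hS, hST, hlow⟩ := exists_positive_conj_eq hT hc hc0.le
  have hSu : IsUnit S := by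
    refine S.isUnit_of_forall_le_norm_inner_map (c := ⟨c ^ 2, by positivity⟩) ?_ fun x => ?_
    · exact NNReal.coe_pos.1 (show 0 < c ^ 2 by positivity)
    · rw [mul_comm]
      exact (hlow x).trans (RCLike.re_le_norm _)
  have hS0 : 0 ≤ S := (ContinuousLinearMap.nonneg_iff_isPositive S).2 hS
  have hQQ : CFC.sqrt S * CFC.sqrt S = S := CFC.sqrt_mul_sqrt_self S hS0
  have hQ : (CFC.sqrt S).IsPositive :=
    (ContinuousLinearMap.nonneg_iff_isPositive _).1 (CFC.sqrt_nonneg S)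
  set Q := CFC.sqrt S
  have hQu : IsUnit Q := (Commute.isUnit_mul_iff rfl).1 (hQQ ▸ hSu) |>.1
  have hbij := ContinuousLinearMap.isUnit_iff_bijective.1 hQu
  have hQi : ∀ x y, inner ℂ (Q x) (Q y) = inner ℂ (S x) y := fun x y => by
    rw [← hQQ, mul_apply_eq_comp]
    exact (hQ.isSymmetric (Q x) y).symm
  have hQT : ∀ x, ‖Q (T x)‖ = ‖Q x‖ := fun x => by
    rw [norm_eq_sqrt_re_inner (𝕜 := ℂ), norm_eq_sqrt_re_inner (𝕜 := ℂ) (Q x), hQi, hQi, hST]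
  let e : H ≃L[ℂ] H := ContinuousLinearEquiv.ofBijective Q
    (LinearMap.ker_eq_bot.2 hbij.1) (LinearMap.range_eq_top.2 hbij.2)
  have he : ∀ x, e x = Q x := fun _ => rfl
  refine ⟨e.symm, fun x => ?_⟩
  rw [ContinuousLinearEquiv.symm_symm, he, hQT, ← he, e.apply_symm_apply]

end

theorem minMod_mul_norm_le {X : Type*} [NormedAddCommGroup X] [NormedSpace ℂ X]
    (T : X →L[ℂ] X) (x : X) : minMod T * ‖x‖ ≤ ‖T x‖ := by
  rcases eq_or_ne x 0 with rfl | hx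
  · simp
  have hx0 : 0 < ‖x‖ := norm_pos_iff.2 hx
  rw [← le_div_iff₀ hx0]
  refine csInf_le ⟨0, by rintro _ ⟨y, -, rfl⟩; exact norm_nonneg _⟩
    ⟨((‖x‖⁻¹ : ℝ) : ℂ) • x, by simp [norm_smul, hx0.ne'], ?_⟩
  simp [norm_smul, div_eq_inv_mul]

theorem isUnit_of_norm_le_of_countable_spectrum {X : Type*} [NormedAddCommGroup X]
    [NormedSpace ℂ X] [CompleteSpace X] {T : X →L[ℂ] X} {c : ℝ} (hc : 0 < c)
    (hT : ∀ x, c * ‖x‖ ≤ ‖T x‖) (hcount : (spectrum ℂ T).Countable) : IsUnit T := by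
  obtain ⟨z, hz, hzc⟩ := Metric.dense_iff.1 (hcount.dense_compl ℂ) 0 (c / 3) (by positivity)
  rw [mem_ball_zero_iff] at hz
  obtain ⟨w, hw⟩ := spectrum.notMem_iff.1 hzc
  have hinv : ‖((w⁻¹ : (X →L[ℂ] X)ˣ) : X →L[ℂ] X)‖ ≤ 3 / (2 * c) := by
    refine ContinuousLinearMap.opNorm_le_bound _ (by positivity) fun y => ?_
    set x := ((w⁻¹ : (X →L[ℂ] X)ˣ) : X →L[ℂ] X) y
    have hwx : z • x - T x = y := by
      have := congrArg (· y) w.mul_inv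
      simpa [hw, Algebra.algebraMap_eq_smul_one] using this
    have h1 : ‖T x‖ ≤ ‖z‖ * ‖x‖ + ‖y‖ := by
      rw [show T x = z • x - y by rw [← hwx]; abel, ← norm_smul]
      exact norm_sub_le _ _
    have h2 : ‖z‖ * ‖x‖ ≤ c / 3 * ‖x‖ := by gcongr
    rw [div_mul_eq_mul_div, le_div_iff₀ (by positivity)]
    linarith [hT x]
  have hneg : ‖-T - (w : X →L[ℂ] X)‖ ≤ ‖z‖ := by
    rw [hw, show -T - (algebraMap ℂ (X →L[ℂ] X) z - T) = - algebraMap ℂ (X →L[ℂ] X) z by abel,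
      norm_neg, Algebra.algebraMap_eq_smul_one]
    refine (norm_smul_le _ _).trans (mul_le_of_le_one_right (norm_nonneg _)
      ContinuousLinearMap.norm_id_le)
  rcases subsingleton_or_nontrivial (X →L[ℂ] X) with hs | hs
  · exact isUnit_of_subsingleton T
  refine (IsUnit.neg_iff T).1 ⟨Units.ofNearby w (-T) (hneg.trans_lt ?_), rfl⟩
  have hpos : 0 < ‖((w⁻¹ : (X →L[ℂ] X)ˣ) : X →L[ℂ] X)‖ := norm_pos_iff.2 (Units.ne_zero _)
  rw [← one_div, lt_div_iff₀ hpos]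
  calc _ ≤ ‖z‖ * (3 / (2 * c)) := by gcongr
    _ ≤ c / 3 * (3 / (2 * c)) := by gcongr
    _ < 1 := by field_simp; norm_num

/-- **Statement 18** (Corollary 4.10): a power-bounded Hilbert-space operator with
`m(Tⁿ) ≥ 1/(C e^{n^s})`, `0 < s < 1/2`, and countable spectrum is similar to a unitary
operator: there is an invertible `L` such that `L⁻¹ T L` is a surjective isometry. -/
theorem countable_spectrum_similar_unitary {H : Type u} [NormedAddCommGroup H]
    [InnerProductSpace ℂ H] [CompleteSpace H] (T : H →L[ℂ] H)
    (hpb : ∃ M : ℝ, ∀ n : ℕ, 1 ≤ n → ‖T ^ n‖ ≤ M)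
    (C s : ℝ) (hC : 0 < C) (hs0 : 0 < s) (hs1 : s < 1 / 2)
    (hlow : ∀ n : ℕ, 1 ≤ n → 1 / (C * Real.exp ((n : ℝ) ^ s)) ≤ minMod (T ^ n))
    (hcount : (spectrum ℂ T).Countable) :
    ∃ L : H ≃L[ℂ] H,
      (∀ x : H, ‖L.symm (T (L x))‖ = ‖x‖) ∧
      Function.Surjective (fun x : H => L.symm (T (L x))) := by
  have hlow' : ∀ n : ℕ, 1 ≤ n → ∀ x, ‖x‖ ≤ C * Real.exp ((n : ℝ) ^ s) * ‖(T ^ n) x‖ := by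
    intro n hn x
    have h1 := (mul_le_mul_of_nonneg_right (hlow n hn) (norm_nonneg x)).trans
      (minMod_mul_norm_le (T ^ n) x)
    rwa [one_div, inv_mul_le_iff₀ (by positivity)] at h1
  obtain ⟨u, rfl⟩ : IsUnit T := by
    refine isUnit_of_norm_le_of_countable_spectrum (c := (C * Real.exp (((1 : ℕ) : ℝ) ^ s))⁻¹)
      (by positivity) (fun x => ?_) hcount
    rw [inv_mul_le_iff₀ (by positivity)]
    simpa only [pow_one] using hlow' 1 le_rfl x
  obtain ⟨M₀, hM₀⟩ := hpb
  obtain ⟨M, hM, hpow⟩ : ∃ M : ℝ, 0 < M ∧ ∀ n : ℕ, ‖(u : H →L[ℂ] H) ^ n‖ ≤ M := by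
    refine ⟨max 1 M₀, by positivity, fun n => ?_⟩
    rcases Nat.eq_zero_or_pos n with rfl | hn
    · rw [pow_zero]; exact ContinuousLinearMap.norm_id_le.trans (le_max_left _ _)
    · exact (hM₀ n hn).trans (le_max_right _ _)
  have hinv : ∀ n : ℕ, ‖((u⁻¹ : (H →L[ℂ] H)ˣ) : H →L[ℂ] H) ^ n‖ ≤
      max 1 C * Real.exp ((n : ℝ) ^ s) := by
    intro n
    have h1 : (1 : ℝ) ≤ Real.exp ((n : ℝ) ^ s) := Real.one_le_exp (by positivity)
    rcases Nat.eq_zero_or_pos n with rfl | hn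
    · rw [pow_zero]
      exact ContinuousLinearMap.norm_id_le.trans
        (one_le_mul_of_one_le_of_one_le (le_max_left _ _) h1)
    · refine ContinuousLinearMap.opNorm_le_bound _ (by positivity) fun y =>
        (hlow' n hn _).trans ?_
      rw [← mul_apply_eq_comp, ← Units.val_pow_eq_pow_val, ← Units.val_pow_eq_pow_val,
        ← Units.val_mul, inv_pow, mul_inv_cancel, Units.val_one, one_apply_eq_self]
      gcongr
      exact le_max_right _ _
  have hb := ContinuousLinearMap.norm_le_mul_norm_pow_apply_of_countable_spectrum hs0 hs1 hpow
    hinv hcount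
  obtain ⟨L, hL⟩ := exists_similar_isometry_of_bounded_orbits hpow (c := M⁻¹)
    (fun n x => by rw [inv_mul_le_iff₀ hM]; exact hb n x) (inv_pos.2 hM)
  have hsurj := (ContinuousLinearMap.isUnit_iff_bijective.1 u.isUnit).2
  exact ⟨L, hL, L.symm.surjective.comp (hsurj.comp L.surjective)⟩
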